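/- Assume n is even. The function φ₃(y) = y² · x₁(y)^{−(n+2)/2} satisfies (∂²φ₃)(y) = 0 at every point y of the open set Ω = {y ∈ ℝ^{n+2} : (y_0, y_1) ≠ (0,0)}. (The gauge-state generator φ₃ of the Gupta–Bleuler triplet for the C_n-massless scalar representation is a solution of the Laplace equation on ℝ^{2,n}.) -/

import Mathlib

open Finset

/-- The diagonal metric of signature `(2,n)` on `ℝ^{n+2}`. -/
def eta (n : ℕ) (a : Fin (n + 2)) : ℝ := if (a : ℕ) < 2 then 1 else -1

/-- Partial derivative in the `a`-th coordinate direction. -/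
noncomputable def pd (n : ℕ) (a : Fin (n + 2)) (f : (Fin (n + 2) → ℝ) → ℂ) :
    (Fin (n + 2) → ℝ) → ℂ :=
  fun y => fderiv ℝ f y (Pi.single a 1)

/-- The quadratic form `y² = Σ_a η_{aa} y_a²` of signature `(2,n)`. -/
def ysq (n : ℕ) (y : Fin (n + 2) → ℝ) : ℝ := ∑ a, eta n a * (y a) ^ 2

/-- The `η`-d'Alembertian `∂²f = Σ_a η_{aa} ∂_a ∂_a f`. -/
noncomputable def box (n : ℕ) (f : (Fin (n + 2) → ℝ) → ℂ) :
    (Fin (n + 2) → ℝ) → ℂ :=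
  fun y => ∑ a, eta n a • pd n a (pd n a f) y

/-- The complex coordinate `x₁(y) = (i/√2)(y₀ + i y₁)`. -/
noncomputable def x1 (n : ℕ) (y : Fin (n + 2) → ℝ) : ℂ :=
  (Complex.I / (Real.sqrt 2 : ℂ)) * ((y 0 : ℂ) + Complex.I * (y 1 : ℂ))

/-- The complex coordinate `x1` as a continuous real-linear map. -/
noncomputable def x1CLM (n : ℕ) : (Fin (n + 2) → ℝ) →L[ℝ] ℂ :=
  (Complex.I / (Real.sqrt 2 : ℂ)) •
    (Complex.ofRealCLM.comp (ContinuousLinearMap.proj 0) +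
      Complex.I • Complex.ofRealCLM.comp (ContinuousLinearMap.proj 1))

theorem x1CLM_apply (n : ℕ) (y : Fin (n + 2) → ℝ) : x1CLM n y = x1 n y := by
  simp [x1CLM, x1, mul_add]

theorem hasFDerivAt_x1 (n : ℕ) (y : Fin (n + 2) → ℝ) : HasFDerivAt (x1 n) (x1CLM n) y := by
  have h : x1 n = x1CLM n := funext fun z => (x1CLM_apply n z).symm
  rw [h]
  exact (x1CLM n).hasFDerivAt

theorem x1_ne_zero {n : ℕ} {y : Fin (n + 2) → ℝ} (hy : (y 0, y 1) ≠ ((0 : ℝ), (0 : ℝ))) :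
    x1 n y ≠ 0 := by
  intro h
  have h2 : (Real.sqrt 2 : ℂ) ≠ 0 := by simp
  have h' : (y 0 : ℂ) + Complex.I * (y 1 : ℂ) = 0 :=
    (mul_eq_zero.1 h).resolve_left (div_ne_zero Complex.I_ne_zero h2)
  have hre := congrArg Complex.re h'
  have him := congrArg Complex.im h'
  simp at hre him
  exact hy (by rw [hre, him])

theorem eta_mul_self (n : ℕ) (a : Fin (n + 2)) : eta n a * eta n a = 1 := by
  unfold eta
  split_ifs <;> norm_num

/-- The differential of `x1` reproduces `x1` when contracted with the position vector. -/
theorem sum_mul_x1_single (n : ℕ) (y : Fin (n + 2) → ℝ) :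
    ∑ a, (y a : ℂ) * x1 n (Pi.single a 1) = x1 n y := by
  rw [← x1CLM_apply n y]
  conv_rhs => rw [← Finset.univ_sum_single y, map_sum]
  refine Finset.sum_congr rfl fun a _ => ?_
  rw [← x1CLM_apply, ← Complex.real_smul, ← map_smul, ← Pi.single_smul, smul_eq_mul, mul_one]

/-- The differential of `x1` is null for the metric `eta`. -/
theorem sum_eta_mul_x1_single_sq (n : ℕ) :
    ∑ a, (eta n a : ℂ) * x1 n (Pi.single a 1) ^ 2 = 0 := by
  rw [Fin.sum_univ_succ, Fin.sum_univ_succ, Finset.sum_eq_zero]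
  · simp [x1, eta, mul_pow]
  · intro a _
    have h1 : (1 : Fin (n + 2)) ≠ a.succ.succ := by
      rw [← Fin.succ_zero_eq_one]
      exact fun h => Fin.succ_ne_zero _ (Fin.succ_injective _ h).symm
    simp [x1, Pi.single_eq_of_ne h1]

theorem pd_eq_of_hasFDerivAt {n : ℕ} {a : Fin (n + 2)} {f : (Fin (n + 2) → ℝ) → ℂ}
    {f' : (Fin (n + 2) → ℝ) →L[ℝ] ℂ} {y : Fin (n + 2) → ℝ} (h : HasFDerivAt f f' y) :
    pd n a f y = f' (Pi.single a 1) := by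
  rw [pd, h.fderiv]

theorem hasFDerivAt_ofReal_apply (n : ℕ) (a : Fin (n + 2)) (y : Fin (n + 2) → ℝ) :
    HasFDerivAt (fun z : Fin (n + 2) → ℝ => (z a : ℂ))
      (Complex.ofRealCLM.comp (ContinuousLinearMap.proj a)) y :=
  (Complex.ofRealCLM.comp
    (ContinuousLinearMap.proj (R := ℝ) (φ := fun _ : Fin (n + 2) => ℝ) a)).hasFDerivAt

theorem hasFDerivAt_ysq (n : ℕ) (y : Fin (n + 2) → ℝ) :
    HasFDerivAt (fun z : Fin (n + 2) → ℝ => (ysq n z : ℂ))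
      (∑ b, (2 * (eta n b : ℂ) * (y b : ℂ)) •
        Complex.ofRealCLM.comp (ContinuousLinearMap.proj b)) y := by
  have h : (fun z : Fin (n + 2) → ℝ => (ysq n z : ℂ)) =
      fun z => ∑ b, (eta n b : ℂ) * (z b : ℂ) ^ 2 := by
    ext z
    simp [ysq]
  rw [h]
  refine HasFDerivAt.fun_sum fun b _ => ?_
  refine (((hasFDerivAt_ofReal_apply n b y).pow 2).const_mul (eta n b : ℂ)).congr_fderiv ?_
  ext v
  simp
  ring

theorem sum_smul_proj_single (n : ℕ) (c : Fin (n + 2) → ℂ) (a : Fin (n + 2)) :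
    (∑ b, c b • Complex.ofRealCLM.comp
      (ContinuousLinearMap.proj (R := ℝ) (φ := fun _ : Fin (n + 2) => ℝ) b)) (Pi.single a 1)
      = c a := by
  simp [Pi.single_apply, apply_ite Complex.ofReal]

theorem hasFDerivAt_x1_zpow {n : ℕ} {y : Fin (n + 2) → ℝ} (hx : x1 n y ≠ 0) (m : ℤ) :
    HasFDerivAt (fun z => x1 n z ^ m) (((m : ℂ) * x1 n y ^ (m - 1)) • x1CLM n) y :=
  (hasDerivAt_zpow m (x1 n y) (Or.inl hx)).comp_hasFDerivAt y (hasFDerivAt_x1 n y)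

theorem pd_ysq_mul_x1_zpow {n : ℕ} {y : Fin (n + 2) → ℝ} (hx : x1 n y ≠ 0) (m : ℤ)
    (a : Fin (n + 2)) :
    pd n a (fun z => (ysq n z : ℂ) * x1 n z ^ m) y =
      2 * (eta n a : ℂ) * ((y a : ℂ) * x1 n y ^ m) +
        m * x1 n (Pi.single a 1) * ((ysq n y : ℂ) * x1 n y ^ (m - 1)) := by
  rw [pd_eq_of_hasFDerivAt ((hasFDerivAt_ysq n y).fun_mul (hasFDerivAt_x1_zpow hx m)),
    add_apply, smul_apply,
    smul_apply, smul_apply, sum_smul_proj_single,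
    x1CLM_apply]
  simp only [smul_eq_mul]
  ring

theorem pd_pd_ysq_mul_x1_zpow {n : ℕ} {y : Fin (n + 2) → ℝ} (hx : x1 n y ≠ 0) (m : ℤ)
    (a : Fin (n + 2)) :
    pd n a (pd n a fun z => (ysq n z : ℂ) * x1 n z ^ m) y =
      2 * (eta n a : ℂ) * x1 n y ^ m +
        4 * m * (eta n a : ℂ) * ((y a : ℂ) * x1 n (Pi.single a 1)) * x1 n y ^ (m - 1) +
        m * (m - 1) * (ysq n y : ℂ) * x1 n y ^ (m - 2) * x1 n (Pi.single a 1) ^ 2 := by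
  have hev : (pd n a fun z => (ysq n z : ℂ) * x1 n z ^ m) =ᶠ[nhds y] fun z =>
      2 * (eta n a : ℂ) * ((z a : ℂ) * x1 n z ^ m) +
        m * x1 n (Pi.single a 1) * ((ysq n z : ℂ) * x1 n z ^ (m - 1)) := by
    filter_upwards [(hasFDerivAt_x1 n y).continuousAt.eventually_ne hx] with z hz
    exact pd_ysq_mul_x1_zpow hz m a
  have hd := ((((hasFDerivAt_ofReal_apply n a y).fun_mul (hasFDerivAt_x1_zpow hx m)).const_mul
    (2 * (eta n a : ℂ))).add
    (((hasFDerivAt_ysq n y).fun_mul (hasFDerivAt_x1_zpow hx (m - 1))).const_mul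
      (m * x1 n (Pi.single a 1)))).congr_of_eventuallyEq hev
  rw [pd_eq_of_hasFDerivAt hd]
  simp only [add_apply, smul_apply,
    sum_smul_proj_single, x1CLM_apply, ContinuousLinearMap.comp_apply,
    ContinuousLinearMap.proj_apply, Pi.single_eq_same, Complex.ofRealCLM_apply, smul_eq_mul,
    Complex.ofReal_one, Int.cast_sub, Int.cast_one]
  rw [show m - 1 - 1 = m - 2 by ring]
  ring

/-- The `η`-d'Alembertian of `y² · x₁ ^ m` is `(2 (n + 2) + 4 m) x₁ ^ m`. -/
theorem box_ysq_mul_x1_zpow {n : ℕ} {y : Fin (n + 2) → ℝ} (hx : x1 n y ≠ 0) (m : ℤ) :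
    box n (fun z => (ysq n z : ℂ) * x1 n z ^ m) y = (2 * (n + 2) + 4 * m) * x1 n y ^ m := by
  have hterm : ∀ a : Fin (n + 2),
      eta n a • pd n a (pd n a fun z => (ysq n z : ℂ) * x1 n z ^ m) y =
        2 * x1 n y ^ m +
          4 * m * x1 n y ^ (m - 1) * ((y a : ℂ) * x1 n (Pi.single a 1)) +
          m * (m - 1) * (ysq n y : ℂ) * x1 n y ^ (m - 2) *
            ((eta n a : ℂ) * x1 n (Pi.single a 1) ^ 2) := by
    intro a
    have he : (eta n a : ℂ) * eta n a = 1 := by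
      exact_mod_cast congrArg ((↑) : ℝ → ℂ) (eta_mul_self n a)
    rw [pd_pd_ysq_mul_x1_zpow hx, Complex.real_smul]
    linear_combination (2 * x1 n y ^ m +
      4 * m * x1 n y ^ (m - 1) * ((y a : ℂ) * x1 n (Pi.single a 1))) * he
  rw [_root_.box, Finset.sum_congr rfl fun a _ => hterm a, Finset.sum_add_distrib,
    Finset.sum_add_distrib, ← Finset.mul_sum, ← Finset.mul_sum, ← Finset.mul_sum, sum_mul_x1_single,
    sum_eta_mul_x1_single_sq, mul_assoc (4 * (m : ℂ)), zpow_sub_one₀ hx,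
    inv_mul_cancel_right₀ hx]
  simp only [Finset.sum_const, Finset.card_univ, Fintype.card_fin, nsmul_eq_mul, Nat.cast_add,
    Nat.cast_ofNat]
  ring

/-- For `n` even, the gauge-state generator `φ₃(y) = y² · x₁(y)^{-(n+2)/2}` of
the Gupta–Bleuler triplet for the `C_n`-massless scalar representation is a
solution of the Laplace equation on `ℝ^{2,n}` away from `(y₀,y₁) = (0,0)`.
(Since `n` is even, `(n+2)/2 = n/2 + 1` is an integer.) -/
theorem phi3_harmonic (n : ℕ) (hn : 2 ≤ n) (hneven : Even n)
    (y : Fin (n + 2) → ℝ) (hy : (y 0, y 1) ≠ ((0 : ℝ), (0 : ℝ))) :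
    box n (fun z => (ysq n z : ℂ) * x1 n z ^ (-((n / 2 : ℕ) : ℤ) - 1)) y
      = 0 := by
  obtain ⟨k, rfl⟩ := hneven
  rw [box_ysq_mul_x1_zpow (x1_ne_zero hy), show (k + k) / 2 = k by omega]
  push_cast
  ring
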